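/- Assume τ_k^{s,t} ≠ 0, τ_k^{s+1,t} ≠ 0 and ξ_k^{s,t} ≠ 0 for all k. Then for every n ≥ 1 the polynomial identity x·(P_n^{s+1,t}(x) + α_n^{s,t} P_{n−1}^{s+1,t}(x)) = P_{n+1}^{s,t}(x) + β_n^{s,t} P_n^{s,t}(x) holds, where α_n^{s,t} = ξ_{n+1}^{s,t}τ_n^{s,t}/(τ_{n+1}^{s,t}ξ_n^{s,t}) − ξ_{n+1}^{s,t}ξ_n^{s,t}/(τ_{n+1}^{s,t}τ_n^{s+1,t}) and β_n^{s,t} = ξ_{n+1}^{s,t}τ_n^{s,t}/(τ_{n+1}^{s,t}ξ_n^{s,t}). -/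

import Mathlib

open MeasureTheory

/-- Bimoments `m_{i,j}^{s,t}` of the Cauchy-Jacobi weight. -/
noncomputable def mom (s t i j : ℕ) : ℝ :=
  ∫ p in (Set.Ioo (0:ℝ) 1 ×ˢ Set.Ioo (0:ℝ) 1),
    (p.1 ^ (s + i) * p.2 ^ (s + j) / (p.1 + p.2)) *
      ((1 - p.1) / (1 + p.1)) ^ t * ((1 - p.2) / (1 + p.2)) ^ t

/-- Single moments `φ_i^{s,t} = L_{s,t}(x^i)`. -/
noncomputable def phi (s t i : ℕ) : ℝ :=
  Real.sqrt 2 * ∫ x in Set.Ioo (0:ℝ) 1,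
    (x ^ (s + i) / (1 + x)) * ((1 - x) / (1 + x)) ^ t

/-- Single moments `m_i^{s,t}`. -/
noncomputable def momS (s t i : ℕ) : ℝ :=
  ∫ x in Set.Ioo (0:ℝ) 1, x ^ (s + i) * ((1 - x) / (1 + x)) ^ t

/-- `τ_n^{s,t} = det(m_{i,j}^{s,t})_{i,j=0}^{n-1}` (with `τ_0^{s,t} = 1`). -/
noncomputable def tau (s t n : ℕ) : ℝ :=
  Matrix.det (Matrix.of fun i j : Fin n => mom s t i j)

/-- `ξ_n^{s,t} = det(m_{i,j+1}^{s,t})_{i,j=0}^{n-1}` (with `ξ_0^{s,t} = 1`). -/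
noncomputable def xi (s t n : ℕ) : ℝ :=
  Matrix.det (Matrix.of fun i j : Fin n => mom s t i ((j : ℕ) + 1))

/-- `σ_n^{s,t}`: determinant of the `(n+1)×(n+1)` matrix with first `n` columns the
bimoments and last column `(φ_0^{s,t},…,φ_n^{s,t})`. -/
noncomputable def sig (s t n : ℕ) : ℝ :=
  Matrix.det (Matrix.of fun i j : Fin (n + 1) =>
    if (j : ℕ) < n then mom s t i j else phi s t i)

/-- `ψ_n^{s,t}`: like `σ_n^{s,t}` but with shifted bimoments `m_{i,j+1}^{s,t}`. -/
noncomputable def psi (s t n : ℕ) : ℝ :=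
  Matrix.det (Matrix.of fun i j : Fin (n + 1) =>
    if (j : ℕ) < n then mom s t i ((j : ℕ) + 1) else phi s t i)

/-- `σ̃_n^{s,t}`: determinant of the `(n+1)×(n+1)` matrix with first `n` columns the
bimoments and last column the single moments `(m_0^{s,t},…,m_n^{s,t})`. -/
noncomputable def sigT (s t n : ℕ) : ℝ :=
  Matrix.det (Matrix.of fun i j : Fin (n + 1) =>
    if (j : ℕ) < n then mom s t i j else momS s t i)

/-- `τ̃_n^{s,t}`: determinant of the `n×n` matrix whose rows are the bimoment rows
`i = 0,…,n−2,n`. -/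
noncomputable def tauT (s t n : ℕ) : ℝ :=
  Matrix.det (Matrix.of fun i j : Fin n =>
    mom s t (if (i : ℕ) < n - 1 then (i : ℕ) else n) j)

/-- The monic Cauchy-Jacobi orthogonal polynomial `P_n^{s,t}` (as a real function). -/
noncomputable def P (s t n : ℕ) (x : ℝ) : ℝ :=
  (1 / tau s t n) * Matrix.det (Matrix.of fun i j : Fin (n + 1) =>
    if (j : ℕ) < n then mom s t i j else x ^ (i : ℕ))

/-- The adjacent monic polynomial `Q_n^{s,t}` (as a real function). -/
noncomputable def Q (s t n : ℕ) (x : ℝ) : ℝ :=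
  (1 / xi s t n) * Matrix.det (Matrix.of fun i j : Fin (n + 1) =>
    if (j : ℕ) < n then mom s t i ((j : ℕ) + 1) else x ^ (i : ℕ))

/-- The auxiliary monic polynomial `R_n^{s,t}` (as a real function): first column
`(φ_0,…,φ_n)`, next `n−1` columns the bimoments `m_{i,j}` for `j = 0,…,n−2`,
last column `(1,x,…,x^n)`, normalized by `(−1)^{n−1}/σ_{n−1}^{s,t}`. -/
noncomputable def R (s t n : ℕ) (x : ℝ) : ℝ :=
  ((-1 : ℝ) ^ (n - 1) / sig s t (n - 1)) *
    Matrix.det (Matrix.of fun i j : Fin (n + 1) =>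
      if (j : ℕ) = 0 then phi s t i
      else if (j : ℕ) < n then mom s t i ((j : ℕ) - 1) else x ^ (i : ℕ))

/-- The two-parameter deformed Cauchy inner product `⟨f,g⟩_{s,t}` on real functions. -/
noncomputable def innerF (s t : ℕ) (f g : ℝ → ℝ) : ℝ :=
  ∫ p in (Set.Ioo (0:ℝ) 1 ×ˢ Set.Ioo (0:ℝ) 1),
    (p.1 ^ s * p.2 ^ s / (p.1 + p.2)) * f p.1 * g p.2 *
      ((1 - p.1) / (1 + p.1)) ^ t * ((1 - p.2) / (1 + p.2)) ^ t

/-- The two-parameter deformed Cauchy inner product on real polynomials. -/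
noncomputable def innerP (s t : ℕ) (f g : Polynomial ℝ) : ℝ :=
  innerF s t (fun x => f.eval x) (fun y => g.eval y)

/-- The linear functional `L_{s,t}` on real functions. -/
noncomputable def LF (s t : ℕ) (f : ℝ → ℝ) : ℝ :=
  Real.sqrt 2 * ∫ x in Set.Ioo (0:ℝ) 1,
    (x ^ s / (1 + x)) * f x * ((1 - x) / (1 + x)) ^ t

/-- The linear functional `L_{s,t}` on real polynomials. -/
noncomputable def LP (s t : ℕ) (f : Polynomial ℝ) : ℝ := LF s t (fun x => f.eval x)

open Polynomial in
/-- The linear functional `X ^ i ↦ m i j` on polynomials. -/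
noncomputable def columnFunctional (m : ℕ → ℕ → ℝ) (j : ℕ) : ℝ[X] →ₗ[ℝ] ℝ :=
  Polynomial.lsum fun i => m i j • LinearMap.id

/-- The leading `n × n` minor of an infinite array. -/
noncomputable def leadingMinor (m : ℕ → ℕ → ℝ) (n : ℕ) : ℝ :=
  Matrix.det (Matrix.of fun i j : Fin n => m i j)

/-- The determinant of the first `n` columns of an array bordered by the column `v`. -/
noncomputable def borderedDet (m : ℕ → ℕ → ℝ) (n : ℕ) (v : ℕ → ℝ) : ℝ :=
  Matrix.det (Matrix.of fun i j : Fin (n + 1) => if (j : ℕ) < n then m i j else v i)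

/-- The cofactors of the bordering column in `borderedDet`. -/
noncomputable def borderCofactor (m : ℕ → ℕ → ℝ) (n : ℕ) (i : Fin (n + 1)) : ℝ :=
  (-1) ^ ((i : ℕ) + n) * Matrix.det (Matrix.of fun a b : Fin n => m (i.succAbove a) b)

open Polynomial in
/-- The monic orthogonal polynomial of an array of moments. -/
noncomputable def orthoPoly (m : ℕ → ℕ → ℝ) (n : ℕ) : ℝ[X] :=
  ∑ i : Fin (n + 1), monomial (i : ℕ) (borderCofactor m n i / leadingMinor m n)

lemma columnFunctional_monomial (m : ℕ → ℕ → ℝ) (j i : ℕ) (a : ℝ) :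
    columnFunctional m j (Polynomial.monomial i a) = a * m i j := by
  simp [columnFunctional, Polynomial.lsum_apply, Polynomial.sum_monomial_index, mul_comm]

open Polynomial in
lemma columnFunctional_X_mul (m : ℕ → ℕ → ℝ) (j : ℕ) (q : ℝ[X]) :
    columnFunctional m (j + 1) (X * q) =
      columnFunctional (fun a b => m (a + 1) (b + 1)) j q := by
  induction q using Polynomial.induction_on' with
  | add p q hp hq => rw [mul_add, map_add, map_add, hp, hq]
  | monomial i a => rw [X_mul_monomial, columnFunctional_monomial, columnFunctional_monomial]

lemma borderedDet_eq_sum (m : ℕ → ℕ → ℝ) (n : ℕ) (v : ℕ → ℝ) :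
    borderedDet m n v = ∑ i : Fin (n + 1), borderCofactor m n i * v i := by
  rw [borderedDet, Matrix.det_succ_column _ (Fin.last n)]
  refine Finset.sum_congr rfl fun i _ => ?_
  have h : (Matrix.of fun i j : Fin (n + 1) => if (j : ℕ) < n then m i j else v i).submatrix
      i.succAbove (Fin.last n).succAbove = Matrix.of fun a b : Fin n => m (i.succAbove a) b := by
    ext a b
    simp
  rw [h, borderCofactor]
  simp only [Matrix.of_apply, Fin.val_last, lt_irrefl, if_false]
  ring

lemma borderedDet_column_of_lt (m : ℕ → ℕ → ℝ) {n j : ℕ} (hj : j < n) :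
    borderedDet m n (fun i => m i j) = 0 := by
  refine Matrix.det_zero_of_column_eq (i := ⟨j, by omega⟩) (j := Fin.last n) ?_ fun i => ?_
  · simp [Fin.ext_iff, hj.ne]
  · simp [hj]

lemma borderedDet_column_self (m : ℕ → ℕ → ℝ) (n : ℕ) :
    borderedDet m n (fun i => m i n) = leadingMinor m (n + 1) := by
  unfold borderedDet leadingMinor
  congr 1
  ext i j
  simp only [Matrix.of_apply]
  split_ifs with h
  · rfl
  · rw [show (j : ℕ) = n by omega]

lemma borderCofactor_last (m : ℕ → ℕ → ℝ) (n : ℕ) :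
    borderCofactor m n (Fin.last n) = leadingMinor m n := by
  simp [borderCofactor, leadingMinor, ← two_mul]

lemma borderCofactor_zero (m : ℕ → ℕ → ℝ) (n : ℕ) :
    borderCofactor m n 0 = (-1) ^ n * leadingMinor (fun a b => m (a + 1) b) n := by
  simp [borderCofactor, leadingMinor]

lemma eval_orthoPoly (m : ℕ → ℕ → ℝ) (n : ℕ) (x : ℝ) :
    (orthoPoly m n).eval x = 1 / leadingMinor m n * borderedDet m n (fun i => x ^ i) := by
  rw [orthoPoly, Polynomial.eval_finsetSum, borderedDet_eq_sum, Finset.mul_sum]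
  refine Finset.sum_congr rfl fun i _ => ?_
  rw [Polynomial.eval_monomial]
  ring

lemma columnFunctional_orthoPoly (m : ℕ → ℕ → ℝ) (n j : ℕ) :
    columnFunctional m j (orthoPoly m n) =
      borderedDet m n (fun i => m i j) / leadingMinor m n := by
  rw [orthoPoly, map_sum, borderedDet_eq_sum, Finset.sum_div]
  refine Finset.sum_congr rfl fun i _ => ?_
  rw [columnFunctional_monomial]
  ring

lemma columnFunctional_orthoPoly_of_lt (m : ℕ → ℕ → ℝ) {n j : ℕ} (hj : j < n) :
    columnFunctional m j (orthoPoly m n) = 0 := by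
  rw [columnFunctional_orthoPoly, borderedDet_column_of_lt m hj, zero_div]

lemma columnFunctional_orthoPoly_self (m : ℕ → ℕ → ℝ) (n : ℕ) :
    columnFunctional m n (orthoPoly m n) = leadingMinor m (n + 1) / leadingMinor m n := by
  rw [columnFunctional_orthoPoly, borderedDet_column_self]

lemma coeff_orthoPoly (m : ℕ → ℕ → ℝ) (n : ℕ) (i : Fin (n + 1)) :
    (orthoPoly m n).coeff i = borderCofactor m n i / leadingMinor m n := by
  simp [orthoPoly, Polynomial.coeff_monomial, Fin.val_inj]

lemma coeff_orthoPoly_self (m : ℕ → ℕ → ℝ) {n : ℕ} (h : leadingMinor m n ≠ 0) :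
    (orthoPoly m n).coeff n = 1 := by
  have := coeff_orthoPoly m n (Fin.last n)
  rwa [borderCofactor_last, div_self h] at this

lemma coeff_orthoPoly_zero (m : ℕ → ℕ → ℝ) (n : ℕ) :
    (orthoPoly m n).coeff 0 =
      (-1) ^ n * leadingMinor (fun a b => m (a + 1) b) n / leadingMinor m n := by
  rw [← borderCofactor_zero]
  exact coeff_orthoPoly m n 0

lemma coeff_orthoPoly_of_lt (m : ℕ → ℕ → ℝ) {n i : ℕ} (hi : n < i) :
    (orthoPoly m n).coeff i = 0 := by
  rw [orthoPoly, Polynomial.finsetSum_coeff]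
  exact Finset.sum_eq_zero fun a _ => Polynomial.coeff_monomial_of_ne _ (by omega)

open Polynomial Matrix in
lemma vecMul_coeff (m : ℕ → ℕ → ℝ) {n : ℕ} {q : ℝ[X]} (hq : ∀ i, n ≤ i → q.coeff i = 0) :
    (fun i : Fin n => q.coeff i) ᵥ* (Matrix.of fun i j : Fin n => m i j) =
      fun j : Fin n => columnFunctional m j q := by
  ext j
  have hsum : q = ∑ i : Fin n, monomial (i : ℕ) (q.coeff i) := by
    ext i
    rw [finsetSum_coeff]
    rcases lt_or_ge i n with h | h
    · rw [Finset.sum_eq_single (⟨i, h⟩ : Fin n)]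
      · simp
      · intro b _ hb
        exact coeff_monomial_of_ne _ fun e => hb (Fin.ext e.symm)
      · simp
    · rw [hq i h]
      exact (Finset.sum_eq_zero fun a _ => coeff_monomial_of_ne _ (by omega)).symm
  conv_rhs => rw [hsum, map_sum]
  simp [Matrix.vecMul, dotProduct, columnFunctional_monomial]

open Polynomial in
lemma eq_zero_of_columnFunctional_eq_zero (m : ℕ → ℕ → ℝ) {n : ℕ} {q : ℝ[X]}
    (hm : leadingMinor m n ≠ 0) (hq : ∀ i, n ≤ i → q.coeff i = 0)
    (h : ∀ j < n, columnFunctional m j q = 0) : q = 0 := by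
  have hv : (fun i : Fin n => q.coeff i) = 0 := by
    refine Matrix.eq_zero_of_vecMul_eq_zero hm ?_
    rw [vecMul_coeff m hq]
    exact funext fun j => h j j.2
  ext i
  rcases lt_or_ge i n with hi | hi
  · exact congrFun hv ⟨i, hi⟩
  · exact hq i hi

open Polynomial Matrix in
/-- Cramer's rule for the constant coefficient of a polynomial that is annihilated by all but the
last column functional. -/
lemma coeff_zero_mul_leadingMinor (m : ℕ → ℕ → ℝ) {k : ℕ} {q : ℝ[X]}
    (hq : ∀ i, k + 1 ≤ i → q.coeff i = 0) (h : ∀ j < k, columnFunctional m j q = 0) :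
    q.coeff 0 * leadingMinor m (k + 1) =
      columnFunctional m k q * ((-1) ^ k * leadingMinor (fun a b => m (a + 1) b) k) := by
  set A : Matrix (Fin (k + 1)) (Fin (k + 1)) ℝ := Matrix.of fun i j => m i j with hA
  have hv := congrArg (· ᵥ* A.adjugate) (vecMul_coeff m hq)
  simp only [← hA, vecMul_vecMul, Matrix.mul_adjugate, vecMul_smul, vecMul_one] at hv
  have h0 := congrFun hv 0
  rw [Pi.smul_apply, smul_eq_mul, Matrix.vecMul, dotProduct,
    Finset.sum_eq_single (Fin.last k)] at h0
  · rw [mul_comm, show leadingMinor m (k + 1) = A.det from rfl]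
    refine h0.trans ?_
    rw [Matrix.adjugate_fin_succ_eq_det_submatrix]
    congr 1
    have : A.submatrix (Fin.succAbove 0) (Fin.last k).succAbove =
        Matrix.of fun a b : Fin k => m (a + 1) b := by
      ext a b
      simp [hA]
    rw [this, leadingMinor]
    simp
  · intro b _ hb
    rw [h b (Fin.val_lt_last hb), zero_mul]
  · simp

/-- The Desnanot–Jacobi identity for leading minors of an array and its shifts. -/
lemma leadingMinor_desnanot_jacobi (m : ℕ → ℕ → ℝ) (k : ℕ)
    (h₁ : leadingMinor m (k + 1) ≠ 0)
    (h₂ : leadingMinor (fun a b => m (a + 1) (b + 1)) k ≠ 0) :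
    leadingMinor m (k + 2) * leadingMinor (fun a b => m (a + 1) (b + 1)) k =
      leadingMinor m (k + 1) * leadingMinor (fun a b => m (a + 1) (b + 1)) (k + 1) -
        leadingMinor (fun a b => m (a + 1) b) (k + 1) *
          leadingMinor (fun a b => m a (b + 1)) (k + 1) := by
  set m' : ℕ → ℕ → ℝ := fun a b => m (a + 1) (b + 1) with hm'
  have hshift : ∀ j q, columnFunctional (fun a b => m a (b + 1)) j q =
      columnFunctional m (j + 1) q := fun j q => rfl
  have key := coeff_zero_mul_leadingMinor (fun a b => m a (b + 1)) (k := k)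
    (q := orthoPoly m (k + 1) - Polynomial.X * orthoPoly m' k) ?_ ?_
  · rw [hshift, map_sub, columnFunctional_X_mul, ← hm', columnFunctional_orthoPoly_self,
      columnFunctional_orthoPoly_self, Polynomial.coeff_sub, Polynomial.mul_coeff_zero,
      Polynomial.coeff_X_zero, zero_mul, sub_zero, coeff_orthoPoly_zero] at key
    field_simp at key
    rw [pow_succ] at key
    refine mul_right_cancel₀ (pow_ne_zero k (neg_ne_zero.2 (one_ne_zero' ℝ))) ?_
    linear_combination -key
  · intro i hi
    obtain ⟨i, rfl⟩ : ∃ l, i = l + 1 := ⟨i - 1, by omega⟩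
    rw [Polynomial.coeff_sub, Polynomial.coeff_X_mul]
    rcases (show k ≤ i by omega).eq_or_lt with rfl | hlt
    · rw [coeff_orthoPoly_self m h₁, coeff_orthoPoly_self m' h₂, sub_self]
    · rw [coeff_orthoPoly_of_lt m (by omega), coeff_orthoPoly_of_lt m' hlt, sub_self]
  · intro j hj
    rw [hshift, map_sub, columnFunctional_X_mul, ← hm', columnFunctional_orthoPoly_of_lt m',
      columnFunctional_orthoPoly_of_lt m, sub_self] <;> omega

open Polynomial in
/-- The Christoffel-type relation between the orthogonal polynomials of an array and of its
diagonal shift. -/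
lemma X_mul_orthoPoly_add (m : ℕ → ℕ → ℝ) (k : ℕ) {α β : ℝ}
    (h₁ : ∀ n, leadingMinor m n ≠ 0)
    (h₂ : ∀ n, leadingMinor (fun a b => m (a + 1) (b + 1)) n ≠ 0)
    (hβ : (orthoPoly m (k + 2)).coeff 0 + β * (orthoPoly m (k + 1)).coeff 0 = 0)
    (hα : α * (leadingMinor (fun a b => m (a + 1) (b + 1)) (k + 1) /
        leadingMinor (fun a b => m (a + 1) (b + 1)) k) =
      β * (leadingMinor m (k + 2) / leadingMinor m (k + 1))) :
    X * (orthoPoly (fun a b => m (a + 1) (b + 1)) (k + 1) +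
        C α * orthoPoly (fun a b => m (a + 1) (b + 1)) k) =
      orthoPoly m (k + 2) + C β * orthoPoly m (k + 1) := by
  set m' : ℕ → ℕ → ℝ := fun a b => m (a + 1) (b + 1) with hm'
  set S := orthoPoly m (k + 2) + C β * orthoPoly m (k + 1) with hS
  have hX : X * S.divX = S := by
    have := S.X_mul_divX_add
    rwa [show S.coeff 0 = 0 by simpa [hS] using hβ, C_0, add_zero] at this
  have hE : orthoPoly m' (k + 1) + C α * orthoPoly m' k - S.divX = 0 := by
    refine eq_zero_of_columnFunctional_eq_zero m' (h₂ (k + 1)) (fun i hi => ?_) fun j hj => ?_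
    · simp only [coeff_sub, coeff_add, coeff_C_mul, coeff_divX, hS]
      rw [coeff_orthoPoly_of_lt m' (show k < i by omega),
        coeff_orthoPoly_of_lt m (show k + 1 < i + 1 by omega)]
      rcases hi.eq_or_lt with rfl | hlt
      · rw [coeff_orthoPoly_self m' (h₂ _), coeff_orthoPoly_self m (h₁ _)]
        ring
      · rw [coeff_orthoPoly_of_lt m' hlt, coeff_orthoPoly_of_lt m (by omega)]
        ring
    · rw [map_sub, ← columnFunctional_X_mul m j S.divX, hX, hS]
      simp only [← smul_eq_C_mul, map_add, map_smul, smul_eq_mul]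
      rw [columnFunctional_orthoPoly_of_lt m' hj,
        columnFunctional_orthoPoly_of_lt m (show j + 1 < k + 2 by omega)]
      rcases (show j ≤ k by omega).eq_or_lt with rfl | hlt
      · rw [columnFunctional_orthoPoly_self, columnFunctional_orthoPoly_self, hα]
        ring
      · rw [columnFunctional_orthoPoly_of_lt m' hlt,
          columnFunctional_orthoPoly_of_lt m (show j + 1 < k + 1 by omega)]
        ring
  rw [sub_eq_zero.1 hE, hX]

lemma mom_comm (s t i j : ℕ) : mom s t i j = mom s t j i := by
  unfold mom
  rw [Measure.volume_eq_prod, ← setIntegral_prod_swap]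
  congr 1
  ext p
  simp only [Prod.fst_swap, Prod.snd_swap, add_comm p.2 p.1]
  ring

lemma mom_succ (s t : ℕ) : mom (s + 1) t = fun i j => mom s t (i + 1) (j + 1) := by
  ext i j
  simp only [mom, add_assoc, add_comm 1]

lemma leadingMinor_mom_succ_row (s t n : ℕ) :
    leadingMinor (fun a b => mom s t (a + 1) b) n = xi s t n := by
  rw [leadingMinor, xi, ← Matrix.det_transpose]
  congr 1
  ext i j
  exact mom_comm ..

/-- the discrete spectral transformation in the `s`-direction,
`x(P_n^{s+1,t} + α_n^{s,t}P_{n−1}^{s+1,t}) = P_{n+1}^{s,t} + β_n^{s,t}P_n^{s,t}`. -/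
theorem spectral_transformation_I (s t : ℕ)
    (h₁ : ∀ k, tau s t k ≠ 0) (h₂ : ∀ k, tau (s + 1) t k ≠ 0) (h₃ : ∀ k, xi s t k ≠ 0)
    (n : ℕ) (hn : 1 ≤ n) (x : ℝ) :
    x * (P (s + 1) t n x +
        (xi s t (n + 1) * tau s t n / (tau s t (n + 1) * xi s t n) -
          xi s t (n + 1) * xi s t n / (tau s t (n + 1) * tau (s + 1) t n)) *
          P (s + 1) t (n - 1) x) =
      P s t (n + 1) x +
        (xi s t (n + 1) * tau s t n / (tau s t (n + 1) * xi s t n)) * P s t n x := by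
  obtain ⟨k, rfl⟩ : ∃ l, n = l + 1 := ⟨n - 1, by omega⟩
  have hP : ∀ s n, P s t n x = (orthoPoly (mom s t) n).eval x := fun s n =>
    (eval_orthoPoly (mom s t) n x).symm
  have hξ := leadingMinor_mom_succ_row s t
  have hτ : ∀ s n, leadingMinor (mom s t) n = tau s t n := fun _ _ => rfl
  have hτ' : ∀ n, leadingMinor (fun a b => mom s t (a + 1) (b + 1)) n = tau (s + 1) t n :=
    fun n => by rw [← mom_succ, hτ]
  have hJ := leadingMinor_desnanot_jacobi (mom s t) k (h₁ _) (hτ' k ▸ h₂ k)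
  rw [show leadingMinor (fun a b => mom s t a (b + 1)) (k + 1) = xi s t (k + 1) from rfl,
    hξ, hτ, hτ, hτ', hτ'] at hJ
  have a₁ := h₁ (k + 1)
  have a₂ := h₁ (k + 2)
  have b₁ := h₂ k
  have b₂ := h₂ (k + 1)
  have c₁ := h₃ (k + 1)
  have key := X_mul_orthoPoly_add (mom s t) k
    (α := xi s t (k + 2) * tau s t (k + 1) / (tau s t (k + 2) * xi s t (k + 1)) -
      xi s t (k + 2) * xi s t (k + 1) / (tau s t (k + 2) * tau (s + 1) t (k + 1)))
    (β := xi s t (k + 2) * tau s t (k + 1) / (tau s t (k + 2) * xi s t (k + 1)))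
    h₁ (fun n => hτ' n ▸ h₂ n) ?_ ?_
  · have := congrArg (Polynomial.eval x) key
    rw [← mom_succ] at this
    simpa only [Polynomial.eval_mul, Polynomial.eval_add, Polynomial.eval_X, Polynomial.eval_C,
      ← hP, Nat.add_sub_cancel] using this
  · rw [coeff_orthoPoly_zero, coeff_orthoPoly_zero, hξ, hξ, hτ, hτ]
    field_simp
    ring
  · rw [hτ', hτ', hτ, hτ]
    field_simp
    linear_combination (-xi s t (k + 2)) * hJ
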